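/- arXiv:2511.21791 — 2 statements merged into one kernel-verified Lean document; each statement's English description precedes it below -/
import Mathlib

section
/- Let S be a finite thick generalized quadrangle of order (s,t) and let x, y be two noncollinear points of S. Then the hyperbolic line {x,y}^{⊥⊥} has size at least |Ẽ(x)| + 1, where Ẽ(x) is the full group of symmetries with center x. -/
open Equiv

section GQDefs

variable {P L : Type*}

/-- A generalized quadrangle of order `(s,t)`: every line has `s+1` points, every point is
on `t+1` lines, two distinct points are on at most one common line, and for every
non-incident point-line pair `(p, ℓ)` there is a unique pair `(q, M)` with `M` a line
through `p` and `q` a point incident with both `M` and `ℓ`. -/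
structure IsGQ (I : P → L → Prop) (s t : ℕ) : Prop where
  point_count : ∀ ℓ : L, Nat.card {p : P // I p ℓ} = s + 1
  line_count : ∀ p : P, Nat.card {ℓ : L // I p ℓ} = t + 1
  unique_line : ∀ ⦃p q : P⦄, p ≠ q → ∀ ⦃ℓ m : L⦄, I p ℓ → I q ℓ → I p m → I q m → ℓ = m
  quad : ∀ ⦃p : P⦄ ⦃ℓ : L⦄, ¬ I p ℓ →
    ∃! qM : P × L, I p qM.2 ∧ I qM.1 qM.2 ∧ I qM.1 ℓ

/-- Two points are collinear if some line is incident with both. -/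
def Coll (I : P → L → Prop) (x y : P) : Prop := ∃ ℓ : L, I x ℓ ∧ I y ℓ

/-- The automorphism group of an incidence structure, as a subgroup of
`Perm P × Perm L`: pairs of permutations preserving incidence. -/
def autGroup (I : P → L → Prop) : Subgroup (Perm P × Perm L) where
  carrier := {g | ∀ p ℓ, I (g.1 p) (g.2 ℓ) ↔ I p ℓ}
  one_mem' := fun _ _ => Iff.rfl
  mul_mem' := fun {a b} ha hb p ℓ => (ha (b.1 p) (b.2 ℓ)).trans (hb p ℓ)
  inv_mem' := by
    intro a ha p ℓ
    have h := ha (a⁻¹.1 p) (a⁻¹.2 ℓ)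
    simpa using h.symm

/-- The full group `Ẽ(p)` of symmetries with center `p`: automorphisms fixing every
point collinear with `p`. -/
def symmGroup (I : P → L → Prop) (p : P) : Subgroup (Perm P × Perm L) where
  carrier := {g | g ∈ autGroup I ∧ ∀ y : P, Coll I p y → g.1 y = y}
  one_mem' := ⟨(autGroup I).one_mem, fun _ _ => rfl⟩
  mul_mem' := by
    rintro a b ⟨ha, ha'⟩ ⟨hb, hb'⟩
    refine ⟨(autGroup I).mul_mem ha hb, fun y hy => ?_⟩
    have : (a * b).1 y = a.1 (b.1 y) := rfl
    rw [this, hb' y hy, ha' y hy]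
  inv_mem' := by
    rintro a ⟨ha, ha'⟩
    refine ⟨(autGroup I).inv_mem ha, fun y hy => ?_⟩
    have h : a⁻¹.1 (a.1 y) = y := by simp
    rw [ha' y hy] at h
    exact h

/-- `x^⊥`: the set of points collinear with `x` (including `x` itself). -/
def perpSet (I : P → L → Prop) (x : P) : Set P := {y | Coll I x y}

/-- The hyperbolic line `{x,y}^{⊥⊥}`: points collinear with every point of
`{x,y}^⊥ = x^⊥ ∩ y^⊥`. -/
def hypLine (I : P → L → Prop) (x y : P) : Set P :=
  {z | ∀ w ∈ perpSet I x ∩ perpSet I y, Coll I z w}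

/-- The group `G` generated by all the point-symmetries of the quadrangle. -/
def bigGroup (I : P → L → Prop) : Subgroup (Perm P × Perm L) :=
  ⨆ x : P, symmGroup I x

/-- The set `P_r` of `r`-points: points whose full group of symmetries has order
divisible by `r`. -/
def Pr (I : P → L → Prop) (r : ℕ) : Set P :=
  {y | r ∣ Nat.card (symmGroup I y)}

/-- The set `L_r` of lines incident with at least two points of `P_r`. -/
def Lr (I : P → L → Prop) (r : ℕ) : Set L :=
  {ℓ | ∃ x y : P, x ≠ y ∧ x ∈ Pr I r ∧ y ∈ Pr I r ∧ I x ℓ ∧ I y ℓ}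

/-- The stabilizer `G_u` of a point `u` in a group `G` of automorphisms. -/
def stabPt (G : Subgroup (Perm P × Perm L)) (u : P) : Subgroup (Perm P × Perm L) where
  carrier := {g | g ∈ G ∧ g.1 u = u}
  one_mem' := ⟨G.one_mem, rfl⟩
  mul_mem' := by
    rintro a b ⟨ha, ha'⟩ ⟨hb, hb'⟩
    refine ⟨G.mul_mem ha hb, ?_⟩
    have : (a * b).1 u = a.1 (b.1 u) := rfl
    rw [this, hb', ha']
  inv_mem' := by
    rintro a ⟨ha, ha'⟩
    refine ⟨G.inv_mem ha, ?_⟩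
    have h : a⁻¹.1 (a.1 u) = u := by simp
    rw [ha'] at h
    exact h

/-- The setwise stabilizer `G_ℓ` of a line `ℓ` in a group `G` of automorphisms. -/
def stabLine (G : Subgroup (Perm P × Perm L)) (ℓ : L) : Subgroup (Perm P × Perm L) where
  carrier := {g | g ∈ G ∧ g.2 ℓ = ℓ}
  one_mem' := ⟨G.one_mem, rfl⟩
  mul_mem' := by
    rintro a b ⟨ha, ha'⟩ ⟨hb, hb'⟩
    refine ⟨G.mul_mem ha hb, ?_⟩
    have : (a * b).2 ℓ = a.2 (b.2 ℓ) := rfl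
    rw [this, hb', ha']
  inv_mem' := by
    rintro a ⟨ha, ha'⟩
    refine ⟨G.inv_mem ha, ?_⟩
    have h : a⁻¹.2 (a.2 ℓ) = ℓ := by simp
    rw [ha'] at h
    exact h

/-- Isomorphism of incidence structures: a pair of bijections between the point sets and
the line sets preserving incidence in both directions. -/
def IsoTo {P L P' L' : Type*} (I : P → L → Prop) (I' : P' → L' → Prop) : Prop :=
  ∃ (e : P ≃ P') (f : L ≃ L'), ∀ p ℓ, I' (e p) (f ℓ) ↔ I p ℓ

end GQDefs

section ClassicalGQs

/-- The standard nondegenerate alternating bilinear form on `F^4`. -/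
def sympForm {F : Type*} [Field F] (x y : Fin 4 → F) : F :=
  x 0 * y 1 - x 1 * y 0 + x 2 * y 3 - x 3 * y 2

/-- Points of `W(3,q)`: the `1`-dimensional subspaces of `F_q^4`. -/
def W3Point (F : Type*) [Field F] : Type _ :=
  {W : Submodule F (Fin 4 → F) // Module.finrank F W = 1}

/-- Lines of `W(3,q)`: the `2`-dimensional totally isotropic subspaces of `F_q^4` with
respect to a nondegenerate alternating form. -/
def W3Line (F : Type*) [Field F] : Type _ :=
  {U : Submodule F (Fin 4 → F) //
    Module.finrank F U = 2 ∧ ∀ x ∈ U, ∀ y ∈ U, sympForm x y = 0}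

/-- Incidence in `W(3,q)` is given by inclusion. -/
def W3Incid (F : Type*) [Field F] : W3Point F → W3Line F → Prop :=
  fun W U => W.1 ≤ U.1

/-- The standard nondegenerate Hermitian sesquilinear form on `F_{q²}^4`, relative to the
field automorphism `x ↦ x^q`. -/
def hermForm3 {F : Type*} [Field F] (q : ℕ) (x y : Fin 4 → F) : F :=
  x 0 * y 1 ^ q + x 1 * y 0 ^ q + x 2 * y 3 ^ q + x 3 * y 2 ^ q

/-- The standard nondegenerate Hermitian sesquilinear form on `F_{q²}^5`, relative to the
field automorphism `x ↦ x^q`. -/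
def hermForm4 {F : Type*} [Field F] (q : ℕ) (x y : Fin 5 → F) : F :=
  x 0 * y 1 ^ q + x 1 * y 0 ^ q + x 2 * y 3 ^ q + x 3 * y 2 ^ q + x 4 * y 4 ^ q

/-- Points of `H(3,q²)`: the `1`-dimensional isotropic subspaces of `F_{q²}^4`. -/
def H3Point (F : Type*) [Field F] (q : ℕ) : Type _ :=
  {W : Submodule F (Fin 4 → F) //
    Module.finrank F W = 1 ∧ ∀ x ∈ W, hermForm3 q x x = 0}

/-- Lines of `H(3,q²)`: the `2`-dimensional totally isotropic subspaces of `F_{q²}^4`. -/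
def H3Line (F : Type*) [Field F] (q : ℕ) : Type _ :=
  {U : Submodule F (Fin 4 → F) //
    Module.finrank F U = 2 ∧ ∀ x ∈ U, ∀ y ∈ U, hermForm3 q x y = 0}

/-- Incidence in `H(3,q²)` is given by inclusion. -/
def H3Incid (F : Type*) [Field F] (q : ℕ) : H3Point F q → H3Line F q → Prop :=
  fun W U => W.1 ≤ U.1

/-- Points of `H(4,q²)`: the `1`-dimensional isotropic subspaces of `F_{q²}^5`. -/
def H4Point (F : Type*) [Field F] (q : ℕ) : Type _ :=
  {W : Submodule F (Fin 5 → F) //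
    Module.finrank F W = 1 ∧ ∀ x ∈ W, hermForm4 q x x = 0}

/-- Lines of `H(4,q²)`: the `2`-dimensional totally isotropic subspaces of `F_{q²}^5`. -/
def H4Line (F : Type*) [Field F] (q : ℕ) : Type _ :=
  {U : Submodule F (Fin 5 → F) //
    Module.finrank F U = 2 ∧ ∀ x ∈ U, ∀ y ∈ U, hermForm4 q x y = 0}

/-- Incidence in `H(4,q²)` is given by inclusion. -/
def H4Incid (F : Type*) [Field F] (q : ℕ) : H4Point F q → H4Line F q → Prop :=
  fun W U => W.1 ≤ U.1

end ClassicalGQs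

section Projection

variable {P L : Type*} {I : P → L → Prop} {s t : ℕ}

theorem Coll.symm {x y : P} (h : Coll I x y) : Coll I y x :=
  let ⟨ℓ, hx, hy⟩ := h
  ⟨ℓ, hy, hx⟩

theorem IsGQ.exists_line (hGQ : IsGQ I s t) (p : P) : ∃ ℓ, I p ℓ := by
  have : 0 < Nat.card {ℓ : L // I p ℓ} := by rw [hGQ.line_count]; omega
  obtain ⟨⟨ℓ, hℓ⟩⟩ := (Nat.card_pos_iff.mp this).1
  exact ⟨ℓ, hℓ⟩

theorem IsGQ.coll_refl (hGQ : IsGQ I s t) (p : P) : Coll I p p :=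
  let ⟨ℓ, h⟩ := hGQ.exists_line p
  ⟨ℓ, h, h⟩

/-- A point off a line is collinear with at most one point of that line. -/
theorem IsGQ.proj_unique (hGQ : IsGQ I s t) {p q r : P} {ℓ : L} (hp : ¬ I p ℓ)
    (hq : I q ℓ) (hr : I r ℓ) (hpq : Coll I p q) (hpr : Coll I p r) : q = r := by
  obtain ⟨m, hpm, hqm⟩ := hpq
  obtain ⟨n, hpn, hrn⟩ := hpr
  exact congrArg Prod.fst
    ((hGQ.quad hp).unique (y₁ := (q, m)) (y₂ := (r, n)) ⟨hpm, hqm, hq⟩ ⟨hpn, hrn, hr⟩)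

/-- A point off a line is collinear with some point of that line. -/
theorem IsGQ.exists_proj (hGQ : IsGQ I s t) {p : P} {ℓ : L} (hp : ¬ I p ℓ) :
    ∃ q, I q ℓ ∧ Coll I p q := by
  obtain ⟨⟨q, m⟩, ⟨h₁, h₂, h₃⟩, -⟩ := hGQ.quad hp
  exact ⟨q, h₃, m, h₁, h₂⟩

/-- With `t ≥ 1`, every point lies on a line other than a given one. -/
theorem IsGQ.exists_line_ne (hGQ : IsGQ I s t) (ht : 1 ≤ t) (p : P) (ℓ : L) :
    ∃ m, I p m ∧ m ≠ ℓ := by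
  by_contra! h
  have : Subsingleton {m : L // I p m} :=
    ⟨fun a b => Subtype.ext ((h a a.2).trans (h b b.2).symm)⟩
  have h₁ := hGQ.line_count p
  have h₂ : Nat.card {m : L // I p m} ≤ 1 := Finite.card_le_one_iff_subsingleton.mpr this
  omega

/-- With `s ≥ 2`, every line contains a point other than two given ones. -/
theorem IsGQ.exists_point_ne_ne (hGQ : IsGQ I s t) (hs : 2 ≤ s) (ℓ : L) (p q : P) :
    ∃ r, I r ℓ ∧ r ≠ p ∧ r ≠ q := by
  by_contra! h
  have hsub : {r | I r ℓ} ⊆ {p, q} := fun r hr => by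
    by_cases hrp : r = p
    · exact Or.inl hrp
    · exact Or.inr (h r hr hrp)
  have h₁ : Set.ncard {r | I r ℓ} = s + 1 := hGQ.point_count ℓ
  have h₂ := Set.ncard_le_ncard hsub (Set.toFinite _)
  have h₃ := Set.ncard_insert_le p {q}
  rw [Set.ncard_singleton] at h₃
  omega

end Projection

section Symmetry

variable {P L : Type*} {I : P → L → Prop} {s t : ℕ} {g : Perm P × Perm L} {x y : P}

theorem coll_map_iff (hg : g ∈ autGroup I) {p q : P} :
    Coll I (g.1 p) (g.1 q) ↔ Coll I p q := by
  refine ⟨fun ⟨ℓ, hp, hq⟩ => ⟨g.2.symm ℓ, ?_, ?_⟩,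
    fun ⟨ℓ, hp, hq⟩ => ⟨g.2 ℓ, (hg p ℓ).mpr hp, (hg q ℓ).mpr hq⟩⟩
  · exact (hg _ _).mp (by simpa using hp)
  · exact (hg _ _).mp (by simpa using hq)

theorem IsGQ.line_fixed (hGQ : IsGQ I s t) (hg : g ∈ autGroup I) {p q : P} {ℓ : L}
    (hpq : p ≠ q) (hp : I p ℓ) (hq : I q ℓ) (hgp : g.1 p = p) (hgq : g.1 q = q) :
    g.2 ℓ = ℓ := by
  have h₁ := (hg p ℓ).mpr hp
  have h₂ := (hg q ℓ).mpr hq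
  rw [hgp] at h₁
  rw [hgq] at h₂
  exact hGQ.unique_line hpq h₁ h₂ hp hq

/-- A symmetry with center `x` fixing a point `y` not collinear with `x` fixes every
point collinear with `y`. -/
theorem IsGQ.fixed_of_coll_fixed (hGQ : IsGQ I s t) (ht : 1 ≤ t) (hg : g ∈ symmGroup I x)
    (hxy : ¬ Coll I x y) (hy : g.1 y = y) {z : P} (hyz : Coll I y z) : g.1 z = z := by
  obtain ⟨haut, hfix⟩ := hg
  by_cases hxz : Coll I x z
  · exact hfix z hxz
  obtain ⟨m, hym, hzm⟩ := hyz
  have hxm : ¬ I x m := fun h => hxy ⟨m, h, hym⟩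
  obtain ⟨q, hqm, hxq⟩ := hGQ.exists_proj hxm
  have hqy : q ≠ y := by rintro rfl; exact hxy hxq
  have hm : g.2 m = m := hGQ.line_fixed haut hqy hqm hym (hfix q hxq) hy
  obtain ⟨n, hxn, hqn⟩ := hxq
  obtain ⟨k, hxk, hkn⟩ := hGQ.exists_line_ne ht x n
  have hzk : ¬ I z k := fun h => hxz ⟨k, hxk, h⟩
  obtain ⟨r, hrk, hzr⟩ := hGQ.exists_proj hzk
  have hrm : ¬ I r m := by
    intro h
    have hrq := hGQ.proj_unique hxm h hqm ⟨k, hxk, hrk⟩ ⟨n, hxn, hqn⟩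
    subst hrq
    have hxr : x ≠ r := by rintro rfl; exact hxm h
    exact hkn (hGQ.unique_line hxr hxk hrk hxn hqn)
  have hgz : I (g.1 z) m := by
    have := (haut z m).mpr hzm
    rwa [hm] at this
  have hgzr : Coll I (g.1 z) r := by
    have := (coll_map_iff haut).mpr hzr
    rwa [hfix r ⟨k, hxk, hrk⟩] at this
  exact hGQ.proj_unique hrm hgz hzm hgzr.symm hzr.symm

/-- A symmetry with center `x` fixing a point `y` not collinear with `x` fixes every
point outside the hyperbolic line `{x,y}^{⊥⊥}`. -/
theorem IsGQ.fixed_of_notMem_hypLine (hGQ : IsGQ I s t) (ht : 1 ≤ t)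
    (hg : g ∈ symmGroup I x) (hxy : ¬ Coll I x y) (hy : g.1 y = y) {z : P}
    (hz : z ∉ hypLine I x y) : g.1 z = z := by
  simp only [hypLine, Set.mem_ofPred_eq, not_forall] at hz
  obtain ⟨q, ⟨hxq, m, hym, hqm⟩, hzq⟩ := hz
  by_cases hzm : I z m
  · exact absurd ⟨m, hzm, hqm⟩ hzq
  obtain ⟨u, hum, hzu⟩ := hGQ.exists_proj hzm
  have hxm : ¬ I x m := fun h => hxy ⟨m, h, hym⟩
  have hxu : ¬ Coll I x u := fun h =>
    hzq (hGQ.proj_unique hxm hum hqm h hxq ▸ hzu)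
  exact hGQ.fixed_of_coll_fixed ht hg hxu
    (hGQ.fixed_of_coll_fixed ht hg hxy hy ⟨m, hym, hum⟩) hzu.symm

/-- A symmetry with center `x` fixing a point not collinear with `x` fixes every point. -/
theorem IsGQ.fixed_of_fixed (hGQ : IsGQ I s t) (hs : 2 ≤ s) (ht : 1 ≤ t)
    (hg : g ∈ symmGroup I x) (hxy : ¬ Coll I x y) (hy : g.1 y = y) (z : P) :
    g.1 z = z := by
  by_cases hxz : Coll I x z
  · exact hg.2 z hxz
  by_cases hz : z ∈ hypLine I x y
  swap
  · exact hGQ.fixed_of_notMem_hypLine ht hg hxy hy hz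
  -- Join `z` to a point `q` of `{x,y}^⊥`; a third point of that line is fixed.
  have key : ∀ ℓ, I x ℓ → ∃ q, I q ℓ ∧ q ∈ perpSet I x ∩ perpSet I y := fun ℓ hℓ => by
    obtain ⟨q, hq, hyq⟩ := hGQ.exists_proj (p := y) (ℓ := ℓ) fun h => hxy ⟨ℓ, hℓ, h⟩
    exact ⟨q, hq, ⟨ℓ, hℓ, hq⟩, hyq⟩
  obtain ⟨ℓ, hxℓ⟩ := hGQ.exists_line x
  obtain ⟨k, hxk, hkℓ⟩ := hGQ.exists_line_ne ht x ℓ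
  obtain ⟨q, hqℓ, hq⟩ := key ℓ hxℓ
  obtain ⟨r, hrk, hr⟩ := key k hxk
  obtain ⟨n, hzn, hqn⟩ := hz q hq
  have hxn : ¬ I x n := fun h => hxz ⟨n, h, hzn⟩
  obtain ⟨w, hwn, hwz, hwq⟩ := hGQ.exists_point_ne_ne hs n z q
  have hxw : ¬ Coll I x w := fun h => hwq (hGQ.proj_unique hxn hwn hqn h hq.1)
  have hrn : ¬ I r n := by
    intro h
    have hrq := hGQ.proj_unique hxn h hqn hr.1 hq.1
    subst hrq
    have hxr : x ≠ r := by rintro rfl; exact hxn h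
    exact hkℓ (hGQ.unique_line hxr hxk hrk hxℓ hqℓ)
  have hw : w ∉ hypLine I x y := fun h =>
    hwz (hGQ.proj_unique hrn hwn hzn (h r hr).symm (hz r hr).symm)
  exact hGQ.fixed_of_coll_fixed ht hg hxw
    (hGQ.fixed_of_notMem_hypLine ht hg hxy hy hw) ⟨n, hwn, hzn⟩

/-- The symmetries with center `x` act semiregularly on the points not collinear
with `x`. -/
theorem IsGQ.eq_one_of_fixed (hGQ : IsGQ I s t) (hs : 2 ≤ s) (ht : 1 ≤ t)
    (hg : g ∈ symmGroup I x) (hxy : ¬ Coll I x y) (hy : g.1 y = y) : g = 1 := by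
  have hfix := hGQ.fixed_of_fixed hs ht hg hxy hy
  refine Prod.ext (Equiv.ext hfix) (Equiv.ext fun ℓ => ?_)
  obtain ⟨p, hp, -, -⟩ := hGQ.exists_point_ne_ne hs ℓ x x
  obtain ⟨q, hq, hqp, -⟩ := hGQ.exists_point_ne_ne hs ℓ p p
  exact hGQ.line_fixed hg.1 hqp hq hp (hfix q) (hfix p)

/-- Symmetries with center `x` map `y` into the hyperbolic line `{x,y}^{⊥⊥}`. -/
theorem map_mem_hypLine (hg : g ∈ symmGroup I x) : g.1 y ∈ hypLine I x y := by
  rintro w ⟨hxw, hyw⟩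
  have := (coll_map_iff hg.1).mpr hyw
  rwa [hg.2 w hxw] at this

end Symmetry

/-- For two noncollinear points `x, y` of a finite thick generalized quadrangle, the
hyperbolic line `{x,y}^{⊥⊥}` has size at least `|Ẽ(x)| + 1`. -/
theorem hypLine_ge_symmGroup_card_add_one {P L : Type} [Finite P] [Finite L]
    (I : P → L → Prop) (s t : ℕ) (hGQ : IsGQ I s t) (hs : 2 ≤ s) (ht : 2 ≤ t)
    (x y : P) (hxy : ¬ Coll I x y) :
    Nat.card (symmGroup I x) + 1 ≤ Nat.card (hypLine I x y) := by
  have hx : x ∈ hypLine I x y := fun w hw => hw.1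
  have hmoved : ∀ g ∈ symmGroup I x, g.1 y ≠ x := by
    intro g hg h
    have hxx := hGQ.coll_refl x
    have hyx : y = x := g.1.injective (h.trans (hg.2 x hxx).symm)
    exact hxy (hyx ▸ hxx)
  let f : Option (symmGroup I x) → hypLine I x y := fun o =>
    o.elim ⟨x, hx⟩ fun g => ⟨g.1.1 y, map_mem_hypLine g.2⟩
  have hf : Function.Injective f := by
    rintro (_ | g) (_ | h) hgh
    · rfl
    · exact absurd (Subtype.ext_iff.mp hgh).symm (hmoved h.1 h.2)
    · exact absurd (Subtype.ext_iff.mp hgh) (hmoved g.1 g.2)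
    · have hy : g.1.1 y = h.1.1 y := Subtype.ext_iff.mp hgh
      have hfix : (h⁻¹ * g).1.1 y = y := by
        change h.1.1.symm (g.1.1 y) = y
        rw [hy, Equiv.symm_apply_apply]
      have hone := hGQ.eq_one_of_fixed hs (by omega) (h⁻¹ * g).2 hxy hfix
      have : h⁻¹ * g = 1 := Subtype.ext hone
      rw [inv_mul_eq_one.mp this]
  have := Nat.card_le_card_of_injective f hf
  rwa [Finite.card_option] at this
end

section
/- Let S be a finite thick generalized quadrangle in which the full group Ẽ(x) of symmetries with center x is nontrivial for every point x, and let G = ⟨Ẽ(x) : x a point⟩. Let u be a point and r a prime such that the set (P_r ∩ u^⊥) \ {u} is nonempty, where P_r = {y : r divides |Ẽ(y)|}. Then the stabilizer G_u of u in G acts transitively on (P_r ∩ u^⊥) \ {u}. -/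
open Equiv

section Quadrangle

variable {P L : Type*} {I : P → L → Prop} {s t : ℕ}

theorem exists_ne_ne_of_two_lt_card {α : Type*} {p : α → Prop} (h : 2 < Nat.card {x // p x})
    (a b : α) : ∃ c, p c ∧ c ≠ a ∧ c ≠ b := by
  by_contra! hc
  have hsub : {x | p x} ⊆ {a, b} := by
    intro x hx
    by_cases hxa : x = a
    · exact Or.inl hxa
    · exact Or.inr (hc x hx hxa)
  have h₁ := Set.ncard_le_ncard hsub (Set.toFinite _)
  have h₂ := Set.ncard_insert_le a {b}
  have h₃ := Set.ncard_singleton b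
  have h₄ : Nat.card {x // p x} = {x | p x}.ncard := rfl
  omega

theorem Coll.map {g : Perm P × Perm L} (hg : g ∈ autGroup I) {x y : P} (h : Coll I x y) :
    Coll I (g.1 x) (g.1 y) :=
  let ⟨ℓ, hx, hy⟩ := h
  ⟨g.2 ℓ, (hg x ℓ).2 hx, (hg y ℓ).2 hy⟩

namespace IsGQ

theorem exists_point (h : IsGQ I s t) (hs : 2 ≤ s) (ℓ : L) (a b : P) :
    ∃ c, I c ℓ ∧ c ≠ a ∧ c ≠ b :=
  exists_ne_ne_of_two_lt_card (by rw [h.point_count]; omega) a b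

theorem exists_line_s7 (h : IsGQ I s t) (ht : 2 ≤ t) (p : P) (ℓ : L) : ∃ m, I p m ∧ m ≠ ℓ :=
  let ⟨m, hm, hne, _⟩ := exists_ne_ne_of_two_lt_card (by rw [h.line_count]; omega) ℓ ℓ
  ⟨m, hm, hne⟩

theorem coll_refl_s7 (h : IsGQ I s t) (ht : 2 ≤ t) (x : P) : Coll I x x := by
  obtain ⟨⟨m, hm⟩⟩ : Nonempty {ℓ : L // I x ℓ} :=
    (Nat.card_pos_iff.1 (by rw [h.line_count]; omega)).1
  exact ⟨m, hm, hm⟩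

/-- Every point is collinear with some point of every line. -/
theorem exists_proj_s7 (h : IsGQ I s t) (ht : 2 ≤ t) (p : P) (ℓ : L) :
    ∃ q, I q ℓ ∧ Coll I p q := by
  by_cases hp : I p ℓ
  · exact ⟨p, hp, h.coll_refl_s7 ht p⟩
  · obtain ⟨⟨q, m⟩, ⟨h₁, h₂, h₃⟩, -⟩ := h.quad hp
    exact ⟨q, h₃, m, h₁, h₂⟩

/-- There are no triangles: a point collinear with two points of a line lies on that line. -/
theorem incid_of_coll (h : IsGQ I s t) {a b x : P} {ℓ : L} (hab : a ≠ b) (ha : I a ℓ)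
    (hb : I b ℓ) (hxa : Coll I x a) (hxb : Coll I x b) : I x ℓ := by
  by_contra hx
  obtain ⟨m, hxm, ham⟩ := hxa
  obtain ⟨n, hxn, hbn⟩ := hxb
  have := (h.quad hx).unique (y₁ := (a, m)) (y₂ := (b, n)) ⟨hxm, ham, ha⟩ ⟨hxn, hbn, hb⟩
  exact hab (congrArg Prod.fst this)

theorem coll_of_common_neighbors (h : IsGQ I s t) {a b x y : P} (hab : a ≠ b)
    (hc : Coll I a b) (hxa : Coll I x a) (hxb : Coll I x b) (hya : Coll I y a)
    (hyb : Coll I y b) : Coll I x y :=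
  let ⟨ℓ, ha, hb⟩ := hc
  ⟨ℓ, h.incid_of_coll hab ha hb hxa hxb, h.incid_of_coll hab ha hb hya hyb⟩

/-- Two points have two distinct common neighbors, unless they are collinear. -/
theorem exists_common_neighbors (h : IsGQ I s t) (ht : 2 ≤ t) {x z : P}
    (hxz : ¬ Coll I x z) :
    ∃ a b, a ≠ b ∧ Coll I x a ∧ Coll I x b ∧ Coll I z a ∧ Coll I z b := by
  obtain ⟨m, hm, -⟩ := h.coll_refl_s7 ht x
  obtain ⟨n, hn, hnm⟩ := h.exists_line_s7 ht x m
  obtain ⟨a, ham, hza⟩ := h.exists_proj_s7 ht z m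
  obtain ⟨b, hbn, hzb⟩ := h.exists_proj_s7 ht z n
  refine ⟨a, b, ?_, ⟨m, hm, ham⟩, ⟨n, hn, hbn⟩, hza, hzb⟩
  rintro rfl
  have hxa : x ≠ a := by
    rintro rfl
    exact hxz hza.symm
  exact hnm (h.unique_line hxa hn hbn hm ham)

/-- Two distinct points, both collinear with all common neighbors of two noncollinear points,
are noncollinear. -/
theorem not_coll_of_trace (h : IsGQ I s t) (ht : 2 ≤ t) {x y z w : P} (hxy : ¬ Coll I x y)
    (hz : ∀ a, Coll I x a → Coll I y a → Coll I z a)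
    (hw : ∀ a, Coll I x a → Coll I y a → Coll I w a) (hzw : z ≠ w) : ¬ Coll I z w := by
  intro hc
  obtain ⟨a, b, hab, hxa, hxb, hya, hyb⟩ := h.exists_common_neighbors ht hxy
  have := h.coll_of_common_neighbors hzw hc (hz a hxa hya).symm (hw a hxa hya).symm
    (hz b hxb hyb).symm (hw b hxb hyb).symm
  exact hxy (h.coll_of_common_neighbors hab this hxa hxb hya hyb)

/-- A symmetry maps a point noncollinear with the center to a noncollinear point, or fixes it. -/
theorem symm_fixes_of_coll (h : IsGQ I s t) (ht : 2 ≤ t) {x z : P} {g : Perm P × Perm L}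
    (hg : g ∈ symmGroup I x) (hc : Coll I z (g.1 z)) : g.1 z = z := by
  by_cases hxz : Coll I x z
  · exact hg.2 z hxz
  by_contra hne
  refine h.not_coll_of_trace ht hxz (fun a _ hza => hza) (fun a hxa hza => ?_)
    (Ne.symm hne) hc
  have := hza.map hg.1
  rwa [hg.2 a hxa] at this

/-- The fixed points of a symmetry form a subspace. -/
theorem symm_fixes_line (h : IsGQ I s t) (ht : 2 ≤ t) {x a b z : P} {ℓ : L}
    {g : Perm P × Perm L} (hg : g ∈ symmGroup I x) (hab : a ≠ b) (ha : I a ℓ) (hb : I b ℓ)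
    (hga : g.1 a = a) (hgb : g.1 b = b) (hz : I z ℓ) : g.1 z = z := by
  refine h.symm_fixes_of_coll ht hg ⟨ℓ, hz, ?_⟩
  have hℓ : g.2 ℓ = ℓ := by
    refine h.unique_line hab ?_ ?_ ha hb
    · simpa only [hga] using (hg.1 a ℓ).2 ha
    · simpa only [hgb] using (hg.1 b ℓ).2 hb
  simpa only [hℓ] using (hg.1 z ℓ).2 hz

theorem symm_fixes_neighbor (h : IsGQ I s t) (ht : 2 ≤ t) {x y z : P}
    {g : Perm P × Perm L} (hg : g ∈ symmGroup I x) (hxy : ¬ Coll I x y) (hgy : g.1 y = y)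
    (hyz : Coll I y z) : g.1 z = z := by
  obtain ⟨ℓ, hyℓ, hzℓ⟩ := hyz
  obtain ⟨q, hqℓ, hxq⟩ := h.exists_proj_s7 ht x ℓ
  refine h.symm_fixes_line ht hg ?_ hyℓ hqℓ hgy (hg.2 q hxq) hzℓ
  rintro rfl
  exact hxy hxq

/-- A symmetry fixing a point that is not collinear with its center is trivial. -/
theorem symm_eq_one (h : IsGQ I s t) (hs : 2 ≤ s) (ht : 2 ≤ t) {x y : P}
    {g : Perm P × Perm L} (hg : g ∈ symmGroup I x) (hxy : ¬ Coll I x y)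
    (hgy : g.1 y = y) : g = 1 := by
  have hpts : ∀ z, g.1 z = z := by
    intro z
    by_cases hxz : Coll I x z
    · exact hg.2 z hxz
    -- A line through `z` whose projections of `x` and of a fixed point differ fixes `z`.
    have key : ∀ y' : P, ¬ Coll I x y' → g.1 y' = y' → ∀ m, I z m → ∀ a, I a m →
        Coll I x a → ¬ Coll I y' a → g.1 z = z := by
      intro y' hxy' hgy' m hzm a ham hxa hya
      obtain ⟨b, hbm, hyb⟩ := h.exists_proj_s7 ht y' m
      refine h.symm_fixes_line ht hg ?_ ham hbm (hg.2 a hxa)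
        (h.symm_fixes_neighbor ht hg hxy' hgy' hyb) hzm
      rintro rfl
      exact hya hyb
    obtain ⟨m, hzm, -⟩ := h.coll_refl_s7 ht z
    obtain ⟨n, hzn, hnm⟩ := h.exists_line_s7 ht z m
    obtain ⟨a, ham, hxa⟩ := h.exists_proj_s7 ht x m
    obtain ⟨b, hbn, hxb⟩ := h.exists_proj_s7 ht x n
    by_cases hya : Coll I y a
    swap
    · exact key y hxy hgy m hzm a ham hxa hya
    by_cases hyb : Coll I y b
    swap
    · exact key y hxy hgy n hzn b hbn hxb hyb
    obtain ⟨ℓ, hyℓ, haℓ⟩ := hya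
    obtain ⟨y', hy'ℓ, hy'y, hy'a⟩ := h.exists_point hs ℓ y a
    have hxy' : ¬ Coll I x y' := fun hc =>
      hxy ⟨ℓ, h.incid_of_coll hy'a hy'ℓ haℓ hc hxa, hyℓ⟩
    have hgy' : g.1 y' = y' := h.symm_fixes_neighbor ht hg hxy hgy ⟨ℓ, hyℓ, hy'ℓ⟩
    refine key y' hxy' hgy' n hzn b hbn hxb fun hy'b => ?_
    have hab : a ≠ b := by
      rintro rfl
      have hza : z ≠ a := by
        rintro rfl
        exact hxz hxa
      exact hnm (h.unique_line hza hzn hbn hzm ham)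
    have hbℓ : I b ℓ := h.incid_of_coll hy'y hy'ℓ hyℓ hy'b.symm hyb.symm
    exact hxz (h.coll_of_common_neighbors hab ⟨ℓ, haℓ, hbℓ⟩ hxa hxb ⟨m, hzm, ham⟩
      ⟨n, hzn, hbn⟩)
  refine Prod.ext (Equiv.ext hpts) (Equiv.ext fun ℓ => ?_)
  obtain ⟨a, ha, -⟩ := h.exists_point hs ℓ x x
  obtain ⟨b, hb, hba, -⟩ := h.exists_point hs ℓ a a
  refine h.unique_line hba ?_ ?_ hb ha
  · simpa only [hpts] using (hg.1 b ℓ).2 hb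
  · simpa only [hpts] using (hg.1 a ℓ).2 ha

end IsGQ

theorem conj_mem_symmGroup {g k : Perm P × Perm L} {x : P} (hg : g ∈ autGroup I)
    (hk : k ∈ symmGroup I x) : g * k * g⁻¹ ∈ symmGroup I (g.1 x) := by
  refine ⟨mul_mem (mul_mem hg hk.1) (inv_mem hg), fun y hy => ?_⟩
  have hc : Coll I x (g.1⁻¹ y) := by
    simpa using hy.map (inv_mem hg)
  change g.1 (k.1 (g.1⁻¹ y)) = y
  rw [hk.2 _ hc]
  simp

theorem mem_Pr_iff [Finite P] [Finite L] {r : ℕ} (hr : r.Prime) {x : P} :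
    x ∈ Pr I r ↔ ∃ g ∈ symmGroup I x, orderOf g = r := by
  constructor
  · intro hx
    have := Fact.mk hr
    obtain ⟨g, hg⟩ := exists_prime_orderOf_dvd_card' (G := symmGroup I x) r hx
    exact ⟨g, g.2, by rwa [Subgroup.orderOf_coe]⟩
  · rintro ⟨g, hg, rfl⟩
    exact Subgroup.orderOf_dvd_natCard _ hg

theorem map_mem_Pr [Finite P] [Finite L] {r : ℕ} (hr : r.Prime) {x : P}
    {g : Perm P × Perm L} (hg : g ∈ autGroup I) (hx : x ∈ Pr I r) : g.1 x ∈ Pr I r := by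
  obtain ⟨k, hk, hkr⟩ := (mem_Pr_iff hr).1 hx
  refine (mem_Pr_iff hr).2 ⟨g * k * g⁻¹, conj_mem_symmGroup hg hk, ?_⟩
  rw [← MulAut.conj_apply, MulEquiv.orderOf_eq, hkr]

theorem symmGroup_le_bigGroup (x : P) : symmGroup I x ≤ bigGroup I :=
  le_iSup (fun x => symmGroup I x) x

/-- If `f ^ r = 1` with `r` prime and `f` preserves `A`, then `|A|` is congruent modulo `r` to the
number of fixed points of `f` in `A`. -/
theorem ncard_modEq_ncard_fixed [Finite P] {r : ℕ} (hr : r.Prime) {A : Set P} {f : Perm P}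
    (hf : f ^ r = 1) (hA : ∀ w ∈ A, f w ∈ A) :
    A.ncard ≡ {w ∈ A | f w = w}.ncard [MOD r] := by
  classical
  have := Fact.mk hr
  have := Fintype.ofFinite P
  let F : Function.End A := Set.MapsTo.restrict f A A hA
  have hpow : ∀ (n : ℕ) (w : A), (((F ^ n) w : A) : P) = (f ^ n) w := by
    intro n
    induction n with
    | zero => exact fun w => rfl
    | succ n ih =>
      intro w
      rw [pow_succ, pow_succ]
      exact ih (F w)
  have hF : F ^ r ^ 1 = 1 := by
    funext w
    refine Subtype.ext ?_
    rw [pow_one, hpow, hf]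
    rfl
  have hcard := Equiv.Perm.card_fixedPoints_modEq hF
  rw [← Nat.card_eq_fintype_card, ← Nat.card_eq_fintype_card] at hcard
  have himage : {w ∈ A | f w = w} = Set.image Subtype.val (Function.fixedPoints F) := by
    ext w
    constructor
    · rintro ⟨hw, hfw⟩
      exact ⟨⟨w, hw⟩, Subtype.ext hfw, rfl⟩
    · rintro ⟨w, hw, rfl⟩
      exact ⟨w.2, congrArg Subtype.val hw⟩
  rw [himage, Set.ncard_image_of_injective _ Subtype.val_injective]
  exact hcard

/-- Two noncollinear `r`-points are conjugate under automorphisms fixing all their common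
neighbors. -/
theorem IsGQ.exists_conj_of_not_coll [Finite P] [Finite L] (h : IsGQ I s t) (hs : 2 ≤ s)
    (ht : 2 ≤ t) {r : ℕ} (hr : r.Prime) {x y : P} (hx : x ∈ Pr I r) (hy : y ∈ Pr I r)
    (hxy : ¬ Coll I x y) :
    ∃ g ∈ bigGroup I, (∀ a, Coll I x a → Coll I y a → g.1 a = a) ∧ g.1 x = y := by
  let K := symmGroup I x ⊔ symmGroup I y
  have hKaut : K ≤ autGroup I := sup_le (fun _ hg => hg.1) (fun _ hg => hg.1)
  have hKfix : ∀ g ∈ K, ∀ a, Coll I x a → Coll I y a → g.1 a = a := by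
    intro g hg a hxa hya
    have hle : K ≤ (MulAction.stabilizer (Perm P) a).comap (MonoidHom.fst _ _) :=
      sup_le (fun k hk => hk.2 a hxa) (fun k hk => hk.2 a hya)
    exact hle hg
  let A : Set P := {w | ∃ k ∈ K, k.1 x = w}
  have hxA : x ∈ A := ⟨1, one_mem _, rfl⟩
  suffices hyA : y ∈ A by
    obtain ⟨k, hk, hkx⟩ := hyA
    exact ⟨k, sup_le (symmGroup_le_bigGroup x) (symmGroup_le_bigGroup y) hk, hKfix k hk, hkx⟩
  by_contra hyA
  have htrace : ∀ w ∈ A, ∀ a, Coll I x a → Coll I y a → Coll I w a := by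
    rintro _ ⟨k, hk, rfl⟩ a hxa hya
    have := hxa.map (hKaut hk)
    rwa [hKfix k hk a hxa hya] at this
  -- Counting fixed points of an element of order `r` with center `z`.
  have count : ∀ z ∈ Pr I r, symmGroup I z ≤ K →
      (∀ a, Coll I x a → Coll I y a → Coll I z a) →
      A.ncard ≡ {w ∈ A | w = z}.ncard [MOD r] := by
    intro z hz hzK hztr
    obtain ⟨g, hg, hgr⟩ := (mem_Pr_iff hr).1 hz
    have hg1 : g ≠ 1 := by
      rintro rfl
      exact hr.one_lt.ne (by simpa using hgr)
    have hpow : g.1 ^ r = 1 := by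
      rw [← Prod.pow_fst, ← hgr, pow_orderOf_eq_one]
      rfl
    have hA : ∀ w ∈ A, g.1 w ∈ A := by
      rintro _ ⟨k, hk, rfl⟩
      exact ⟨g * k, mul_mem (hzK hg) hk, rfl⟩
    have hset : {w ∈ A | g.1 w = w} = {w ∈ A | w = z} := by
      ext w
      refine and_congr_right fun hw => ⟨fun hgw => ?_, ?_⟩
      · by_contra hne
        exact hg1 (h.symm_eq_one hs ht hg
          (h.not_coll_of_trace ht hxy hztr (htrace w hw) (Ne.symm hne)) hgw)
      · rintro rfl
        exact hg.2 w (h.coll_refl_s7 ht w)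
    rw [← hset]
    exact ncard_modEq_ncard_fixed hr hpow hA
  have hcx := count x hx le_sup_left fun a hxa _ => hxa
  have hcy := count y hy le_sup_right fun a _ hya => hya
  have ex : {w ∈ A | w = x} = {x} := by
    ext w
    exact ⟨fun hw => hw.2, fun hw => ⟨by rwa [show w = x from hw], hw⟩⟩
  have ey : {w ∈ A | w = y} = ∅ := by
    ext w
    refine ⟨fun hw => hyA ?_, fun hw => hw.elim⟩
    obtain ⟨hw, rfl⟩ := hw
    exact hw
  rw [ex, Set.ncard_singleton] at hcx
  rw [ey, Set.ncard_empty] at hcy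
  exact hr.one_lt.ne' (Nat.dvd_one.1 ((Nat.modEq_zero_iff_dvd).1 (hcx.symm.trans hcy)))

end Quadrangle

/-- If every point has a nontrivial full group of symmetries and the set of `r`-points
collinear with `u` (other than `u`) is nonempty, then the stabilizer `G_u` acts
transitively on this set, where `G` is generated by all point-symmetries. -/
theorem stab_transitive_on_rpoints {P L : Type} [Finite P] [Finite L]
    (I : P → L → Prop) (s t : ℕ) (hGQ : IsGQ I s t) (hs : 2 ≤ s) (ht : 2 ≤ t)
    (hE : ∀ x : P, symmGroup I x ≠ ⊥)
    (u : P) (r : ℕ) (hr : r.Prime)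
    (hne : ∃ y : P, y ∈ Pr I r ∧ y ∈ perpSet I u ∧ y ≠ u) :
    ∀ x y : P, x ∈ Pr I r → x ∈ perpSet I u → x ≠ u →
      y ∈ Pr I r → y ∈ perpSet I u → y ≠ u →
      ∃ g ∈ bigGroup I, g.1 u = u ∧ g.1 x = y := by
  intro x y hx hux hxu hy huy hyu
  obtain ⟨ℓ, huℓ, hxℓ⟩ := hux
  obtain ⟨m, hum, hmℓ⟩ := hGQ.exists_line_s7 ht u ℓ
  obtain ⟨v, hvm, hvu, -⟩ := hGQ.exists_point hs m u u
  have hux : Coll I u x := ⟨ℓ, huℓ, hxℓ⟩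
  have hvx : ¬ Coll I v x := fun hc =>
    hmℓ (hGQ.unique_line hvu hvm hum
      (hGQ.incid_of_coll hxu hxℓ huℓ hc ⟨m, hvm, hum⟩) huℓ)
  by_cases hxy : Coll I x y
  swap
  · obtain ⟨g, hg, hfix, hgx⟩ := hGQ.exists_conj_of_not_coll hs ht hr hx hy hxy
    exact ⟨g, hg, hfix u hux.symm huy.symm, hgx⟩
  obtain ⟨⟨g, hg⟩, hg1⟩ := Subgroup.ne_bot_iff_exists_ne_one.1 (hE v)
  have hgu : g.1 u = u := hg.2 u ⟨m, hvm, hum⟩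
  have hxgx : ¬ Coll I x (g.1 x) := fun hc =>
    hg1 (Subtype.ext (hGQ.symm_eq_one hs ht hg hvx (hGQ.symm_fixes_of_coll ht hg hc)))
  have hugx : Coll I u (g.1 x) := by
    simpa only [hgu] using hux.map hg.1
  have hgxy : ¬ Coll I (g.1 x) y := fun hc =>
    hxgx (hGQ.coll_of_common_neighbors hyu huy.symm hxy hux.symm hc hugx.symm)
  obtain ⟨k, hk, hfix, hkx⟩ :=
    hGQ.exists_conj_of_not_coll hs ht hr (map_mem_Pr hr hg.1 hx) hy hgxy
  refine ⟨k * g, mul_mem hk (symmGroup_le_bigGroup v hg), ?_, hkx⟩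
  change k.1 (g.1 u) = u
  rw [hgu]
  exact hfix u hugx.symm huy.symm
end
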